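/- Let f ∈ WRP with sign ε and dual g, so that W_f(β) = ε √(p*)^{n+s} ξ_p^{g(β)} for every β ∈ Supp(W_f). For j ∈ F_p let N_g(j) = #{β ∈ Supp(W_f) : g(β) = j}. If n−s is even, then N_g(0) = p^{n−s−1} + ε η_0(−1)^{n+1}(p−1)√(p*)^{n−s−2} and N_g(j) = p^{n−s−1} − ε η_0(−1)^{n+1}√(p*)^{n−s−2} for every j ∈ F_p^*. If n−s is odd, then N_g(0) = p^{n−s−1}, N_g(j) = p^{n−s−1} + ε η_0(−1)^n √(p*)^{n−s−1} for j ∈ SQ, and N_g(j) = p^{n−s−1} − ε η_0(−1)^n √(p*)^{n−s−1} for j ∈ NSQ. -/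

import Mathlib

open scoped BigOperators Classical

noncomputable section

/-- `ξ_p^j` for `j : ZMod p`, where `ξ_p = exp(2πi/p)` and the exponent `j`
is lifted to a natural number. -/
def ep (p : ℕ) (j : ZMod p) : ℂ :=
  Complex.exp (2 * Real.pi * Complex.I * (j.val : ℂ) / (p : ℂ))

/-- `√(p*)`: equal to `√p` if `p ≡ 1 (mod 4)` and to `i√p` if `p ≡ 3 (mod 4)`. -/
def sqrtPStar (p : ℕ) : ℂ :=
  if p % 4 = 1 then ((Real.sqrt p : ℝ) : ℂ) else Complex.I * ((Real.sqrt p : ℝ) : ℂ)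

/-- The quadratic character `η₀` of `F_p` (extended by `η₀(0) = 0`), with values in `ℂ`. -/
def eta0 (p : ℕ) [Fact p.Prime] (j : ZMod p) : ℂ :=
  ((quadraticChar (ZMod p) j : ℤ) : ℂ)

/-- The Walsh transform of `f : F_q → F_p`. -/
def walsh (p : ℕ) {F : Type*} [Field F] [Fintype F] [Algebra (ZMod p) F]
    (f : F → ZMod p) (β : F) : ℂ :=
  ∑ x : F, ep p (f x - Algebra.trace (ZMod p) F (β * x))

/-- `f` is weakly regular `s`-plateaued with sign `ε` and dual `g`:
`W_f(β) = ε √(p*)^{n+s} ξ_p^{g(β)}` on the Walsh support, `W_f(β) = 0` off it,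
and `g` vanishes off the Walsh support. -/
def IsWeaklyRegularPlateaued (p n s : ℕ) {F : Type*} [Field F] [Fintype F]
    [Algebra (ZMod p) F] (f : F → ZMod p) (ε : ℂ) (g : F → ZMod p) : Prop :=
  (ε = 1 ∨ ε = -1) ∧
  (∀ β : F, walsh p f β ≠ 0 →
      walsh p f β = ε * sqrtPStar p ^ (n + s) * ep p (g β)) ∧
  (∀ β : F, walsh p f β = 0 → g β = 0)

/-- `f` lies in the class `WRP`: weakly regular `s`-plateaued with sign `ε` and dual `g`,
unbalanced, `f(0) = 0`, and `f(ax) = a^h f(x)` for some positive even `h` with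
`gcd(h-1, p-1) = 1`. -/
def IsWRP (p n s : ℕ) {F : Type*} [Field F] [Fintype F]
    [Algebra (ZMod p) F] (f : F → ZMod p) (ε : ℂ) (g : F → ZMod p) : Prop :=
  IsWeaklyRegularPlateaued p n s f ε g ∧
  walsh p f 0 ≠ 0 ∧
  f 0 = 0 ∧
  ∃ h : ℕ, 0 < h ∧ Even h ∧ Nat.gcd (h - 1) (p - 1) = 1 ∧
    ∀ (a : (ZMod p)ˣ) (x : F),
      f (algebraMap (ZMod p) F (a : ZMod p) * x) = (a : ZMod p) ^ h * f x

open Polynomial Finset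

/-- `ξ_p = exp(2πi/p)`. -/
def rootXi (p : ℕ) : ℂ := Complex.exp (2 * Real.pi * Complex.I / p)

lemma rootXi_isPrimitiveRoot (p : ℕ) [NeZero p] : IsPrimitiveRoot (rootXi p) p :=
  Complex.isPrimitiveRoot_exp p (NeZero.ne p)

lemma ep_eq_stdAddChar (p : ℕ) [NeZero p] (j : ZMod p) : ep p j = ZMod.stdAddChar j := by
  have h := ZMod.stdAddChar_coe (N := p) (j.val : ℤ)
  rw [Int.cast_natCast, ZMod.natCast_zmod_val, Int.cast_natCast] at h
  rw [h, ep]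

lemma ep_eq_pow (p : ℕ) (j : ZMod p) : ep p j = rootXi p ^ j.val := by
  rw [ep, rootXi, ← Complex.exp_nat_mul]
  congr 1
  ring

/-- An integer relation between the powers of `ξ_p` has constant coefficients. -/
lemma eq_of_sum_ep_eq_zero (p : ℕ) [hp : Fact p.Prime] (a : ZMod p → ℤ)
    (h : ∑ j, (a j : ℂ) * ep p j = 0) (i j : ZMod p) : a i = a j := by
  have e := ((rootXi_isPrimitiveRoot p).sum_eq_zero_iff_forall_eq_int hp.out
    fun k => a ((ZMod.finEquiv p) k)).1 (by
      rw [← h, ← (ZMod.finEquiv p).toEquiv.sum_comp]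
      refine Finset.sum_congr rfl fun k _ => ?_
      rw [ep_eq_pow]
      congr 2
      obtain ⟨q, rfl⟩ := Nat.exists_eq_succ_of_ne_zero hp.out.ne_zero
      rfl)
  simpa using e ((ZMod.finEquiv p).symm i) ((ZMod.finEquiv p).symm j)

lemma sum_quadraticChar_mul_ep_sq (p : ℕ) [Fact p.Prime] (hp : p ≠ 2) :
    (∑ j, ((quadraticChar (ZMod p) j : ℤ) : ℂ) * ep p j) ^ 2 = eta0 p (-1) * p := by
  have hc : ringChar (ZMod p) ≠ 2 := by rwa [ZMod.ringChar_zmod_n]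
  have hne : (quadraticChar (ZMod p)).ringHomComp (Int.castRingHom ℂ) ≠ 1 :=
    (MulChar.ringHomComp_ne_one_iff (RingHom.injective_int _)).2 (quadraticChar_ne_one hc)
  have h := gaussSum_sq hne ((quadraticChar_isQuadratic (ZMod p)).comp _)
    (ZMod.isPrimitive_stdAddChar p)
  simpa [gaussSum, ep_eq_stdAddChar, eta0] using h

lemma eta0_neg_one_of_mod_four_eq_one (p : ℕ) [Fact p.Prime] (hp : p % 4 = 1) :
    eta0 p (-1) = 1 := by
  have hc : ringChar (ZMod p) ≠ 2 := by rw [ZMod.ringChar_zmod_n]; omega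
  simp [eta0, quadraticChar_neg_one hc, ZMod.χ₄_nat_one_mod_four hp]

lemma eta0_neg_one_of_mod_four_eq_three (p : ℕ) [Fact p.Prime] (hp : p % 4 = 3) :
    eta0 p (-1) = -1 := by
  have hc : ringChar (ZMod p) ≠ 2 := by rw [ZMod.ringChar_zmod_n]; omega
  simp [eta0, quadraticChar_neg_one hc, ZMod.χ₄_nat_three_mod_four hp]

lemma mod_four_eq_one_or_three (p : ℕ) [h : Fact p.Prime] (hp : p ≠ 2) :
    p % 4 = 1 ∨ p % 4 = 3 :=
  Nat.odd_mod_four_iff.1 (h.out.mod_two_eq_one_iff_ne_two.2 hp)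

lemma sqrtPStar_sq (p : ℕ) [Fact p.Prime] (hp : p ≠ 2) :
    sqrtPStar p ^ 2 = eta0 p (-1) * p := by
  have h : ((Real.sqrt p : ℝ) : ℂ) ^ 2 = p := by
    rw [← Complex.ofReal_pow, Real.sq_sqrt p.cast_nonneg, Complex.ofReal_natCast]
  rcases mod_four_eq_one_or_three p hp with h4 | h4
  · rw [eta0_neg_one_of_mod_four_eq_one p h4, sqrtPStar, if_pos h4, h, one_mul]
  · rw [eta0_neg_one_of_mod_four_eq_three p h4, sqrtPStar, if_neg (by omega), mul_pow, h,
      Complex.I_sq]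

/-- The product `∏_{k=1}^{m} X^{mk} (X^k - 1)`; for `m = (p - 1) / 2` its value at `ξ_p` is
a square root of `p*`. -/
def sineProdPoly (m : ℕ) : ℤ[X] := ∏ k ∈ range m, X ^ (m * (k + 1)) * (X ^ (k + 1) - 1)

/-- The quadratic Gauss sum modulo `p` as a polynomial in `ξ_p`. -/
def gaussPoly (p : ℕ) [Fact p.Prime] : ℤ[X] :=
  ∑ j : ZMod p, C (quadraticChar (ZMod p) j) * X ^ j.val

lemma coeff_sineProdPoly_comp (R : Type*) [CommRing R] (m : ℕ) :
    (((sineProdPoly m).map (Int.castRingHom R)).comp (X + 1)).coeff m = (m.factorial : R) := by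
  have key (k : ℕ) : ((X : R[X]) + 1) ^ k - 1 = X * ∑ i ∈ range k, (X + 1) ^ i := by
    rw [← mul_geom_sum, add_sub_cancel_right]
  simp only [sineProdPoly, Polynomial.map_prod, Polynomial.map_mul, Polynomial.map_sub,
    Polynomial.map_pow, map_X, Polynomial.map_one, Polynomial.prod_comp, mul_comp, sub_comp, pow_comp, X_comp,
    one_comp, key, mul_left_comm _ (X : R[X])]
  rw [prod_mul_distrib, prod_const, card_range, coeff_X_pow_mul', if_pos le_rfl, Nat.sub_self,
    coeff_zero_eq_eval_zero, eval_prod, ← prod_range_add_one_eq_factorial, Nat.cast_prod]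
  refine prod_congr rfl fun k _ => ?_
  simp [eval_finsetSum]

lemma sum_pow_mul_eval (p : ℕ) [hp : Fact p.Prime] {m : ℕ} (hm : 2 * m + 1 = p) (f : (ZMod p)[X])
    (hf : f.Monic) (hd : f.natDegree = m) : ∑ j : ZMod p, j ^ m * f.eval j = -1 := by
  have hp1 := hp.out.one_lt
  have h1 : ∑ j : ZMod p, j ^ (m + m) = -1 := by
    rw [← two_mul, show 2 * m = p - 1 by omega]
    have e (j : ZMod p) : j ^ (p - 1) = 1 - if j = 0 then 1 else 0 := by
      split_ifs with h
      · simp [h]; omega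
      · simp [ZMod.pow_card_sub_one_eq_one h]
    simp [e]
  simp only [eval_eq_sum_range, hd, mul_sum]
  rw [sum_comm, sum_range_succ]
  have h0 : ∑ k ∈ range m, ∑ j : ZMod p, j ^ m * (f.coeff k * j ^ k) = 0 := by
    refine sum_eq_zero fun k hk => ?_
    have := FiniteField.sum_pow_lt_card_sub_one (ZMod p) (m + k)
      (by rw [ZMod.card]; have := mem_range.1 hk; omega)
    simp only [mul_left_comm _ (f.coeff k), ← pow_add, ← mul_sum, this, mul_zero]
  have hl : f.coeff m = 1 := by rw [← hd]; exact hf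
  rw [h0, zero_add]
  simpa [hl, ← pow_add] using h1

lemma factorial_mul_coeff_gaussPoly_comp (p : ℕ) [hp : Fact p.Prime] {m : ℕ}
    (hm : 2 * m + 1 = p) :
    (m.factorial : ZMod p) *
      (((gaussPoly p).map (Int.castRingHom (ZMod p))).comp (X + 1)).coeff m = -1 := by
  have hc : ringChar (ZMod p) ≠ 2 := by rw [ZMod.ringChar_zmod_n]; omega
  rw [← sum_pow_mul_eval p hm (descPochhammer (ZMod p) m) (monic_descPochhammer _ _)
    (descPochhammer_natDegree _ _)]
  simp only [gaussPoly, Polynomial.map_sum, Polynomial.map_mul, Polynomial.map_pow, map_X, map_C,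
    Polynomial.sum_comp, mul_comp, pow_comp, X_comp, C_comp, finsetSum_coeff, coeff_C_mul,
    coeff_X_add_one_pow, mul_sum]
  refine sum_congr rfl fun j _ => ?_
  have h1 : ((quadraticChar (ZMod p) j : ℤ) : ZMod p) = j ^ m := by
    rw [quadraticChar_eq_pow_of_char_ne_two' hc, ZMod.card, show p / 2 = m by omega]
  have h2 : (descPochhammer (ZMod p) m).eval j = (m.factorial : ZMod p) * (j.val.choose m) := by
    conv_lhs => rw [← ZMod.natCast_zmod_val j]
    rw [descPochhammer_eval_eq_descFactorial, Nat.descFactorial_eq_factorial_mul_choose,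
      Nat.cast_mul]
  rw [eq_intCast, h1, h2]
  ring

lemma cyclotomic_zmod_self (p : ℕ) [hp : Fact p.Prime] :
    cyclotomic p (ZMod p) = (X - 1) ^ (p - 1) := by
  have h0 : (X - 1 : (ZMod p)[X]) ≠ 0 := by simpa using X_sub_C_ne_zero (1 : ZMod p)
  apply mul_right_cancel₀ h0
  rw [cyclotomic_prime_mul_X_sub_one, ← pow_succ, Nat.sub_add_cancel hp.out.pos, sub_pow_char,
    one_pow]

/-- If an integer polynomial vanishes at `ξ_p`, then modulo `p` it vanishes at `1` to order
`p - 1`. -/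
lemma coeff_comp_eq_zero_of_aeval_eq_zero (p : ℕ) [hp : Fact p.Prime] (f : ℤ[X])
    (hf : aeval (rootXi p) f = 0) {m : ℕ} (hm : m < p - 1) :
    ((f.map (Int.castRingHom (ZMod p))).comp (X + 1)).coeff m = 0 := by
  have hξ := rootXi_isPrimitiveRoot p
  obtain ⟨g, rfl⟩ := minpoly.isIntegrallyClosed_dvd (hξ.isIntegral hp.out.pos) hf
  rw [← cyclotomic_eq_minpoly hξ hp.out.pos, Polynomial.map_mul, map_cyclotomic_int,
    cyclotomic_zmod_self, mul_comp, pow_comp, sub_comp, X_comp, one_comp, add_sub_cancel_right,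
    coeff_X_pow_mul', if_neg (by omega)]

lemma factorial_sq_zmod (p : ℕ) [Fact p.Prime] {m : ℕ} (hm : 2 * m + 1 = p) :
    (m.factorial : ZMod p) ^ 2 = (-1) ^ (m + 1) := by
  have hw := ZMod.wilsons_lemma p
  rw [show p - 1 = m + m by omega, ← prod_range_add_one_eq_factorial, prod_range_add, Nat.cast_mul,
    prod_range_add_one_eq_factorial] at hw
  have h2 : ((∏ k ∈ range m, (m + k + 1) : ℕ) : ZMod p) = (-1) ^ m * m.factorial := by
    rw [← prod_range_reflect, ← prod_range_add_one_eq_factorial, Nat.cast_prod, Nat.cast_prod]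
    rw [show (-1 : ZMod p) ^ m = ∏ k ∈ range m, -1 by simp, ← prod_mul_distrib]
    refine prod_congr rfl fun k hk => ?_
    have hk := mem_range.1 hk
    have : ((m + (m - 1 - k) + 1 + (k + 1) : ℕ) : ZMod p) = 0 := by
      rw [show m + (m - 1 - k) + 1 + (k + 1) = p by omega, ZMod.natCast_self]
    push_cast at this ⊢
    linear_combination this
  rw [h2] at hw
  have h1 : ((-1 : ZMod p) ^ m) * (-1) ^ m = 1 := by rw [← mul_pow]; simp
  linear_combination (-1) ^ m * hw - (m.factorial : ZMod p) ^ 2 * h1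

lemma rootXi_pow_mul_sub_one {p m : ℕ} (hm : 2 * m + 1 = p) (k : ℕ) :
    rootXi p ^ (m * k) * (rootXi p ^ k - 1) =
      (-1) ^ k * Complex.I * ((2 * Real.sin (Real.pi * k / p) : ℝ) : ℂ) := by
  have hp : (p : ℂ) ≠ 0 := by
    rw [← hm]
    exact Nat.cast_ne_zero.2 (by omega)
  have hpm : (p : ℂ) = 2 * m + 1 := by rw [← hm]; push_cast; ring
  push_cast
  rw [Complex.sin]
  set z : ℂ := Real.pi * k / p with hz
  have h1 : rootXi p ^ k = Complex.exp (z * Complex.I) * Complex.exp (z * Complex.I) := by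
    rw [rootXi, ← Complex.exp_nat_mul, ← Complex.exp_add, hz]
    congr 1
    ring
  have h2 : Complex.exp (z * Complex.I) * Complex.exp (-z * Complex.I) = 1 := by
    rw [← Complex.exp_add, neg_mul, add_neg_cancel, Complex.exp_zero]
  have h3 : rootXi p ^ (m * k) * Complex.exp (z * Complex.I) = (-1) ^ k := by
    rw [← Complex.exp_pi_mul_I, ← Complex.exp_nat_mul, rootXi, ← Complex.exp_nat_mul,
      ← Complex.exp_add, hz]
    congr 1
    field_simp
    rw [hpm]
    push_cast
    ring
  rw [h1, ← h3]
  linear_combination (rootXi p ^ (m * k) * (Complex.exp (z * Complex.I) ^ 2 -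
    Complex.exp (z * Complex.I) * Complex.exp (-z * Complex.I))) * Complex.I_sq
      + rootXi p ^ (m * k) * h2

lemma norm_rootXi (p : ℕ) [NeZero p] : ‖rootXi p‖ = 1 :=
  (rootXi_isPrimitiveRoot p).norm'_eq_one (NeZero.ne p)

lemma sin_pi_mul_div_nonneg {p k : ℕ} (hk : k ≤ p) : 0 ≤ Real.sin (Real.pi * k / p) := by
  refine Real.sin_nonneg_of_nonneg_of_le_pi (by positivity) ?_
  rw [mul_div_assoc]
  exact mul_le_of_le_one_right Real.pi_pos.le
    (div_le_one_of_le₀ (Nat.cast_le.2 hk) p.cast_nonneg)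

lemma norm_one_sub_rootXi_pow {p m : ℕ} (hm : 2 * m + 1 = p) {k : ℕ} (hk : k ≤ p) :
    ‖1 - rootXi p ^ k‖ = 2 * Real.sin (Real.pi * k / p) := by
  have : NeZero p := ⟨by omega⟩
  have h := congrArg norm (rootXi_pow_mul_sub_one hm k)
  have hs := sin_pi_mul_div_nonneg hk
  rw [norm_mul, norm_mul, norm_mul, norm_pow, norm_pow, norm_rootXi, Complex.norm_I, norm_neg,
    Complex.norm_real, Real.norm_of_nonneg (by positivity), norm_sub_rev] at h
  simpa using h

/-- `∏_{k=1}^{(p-1)/2} 2 sin(πk/p) = √p`. -/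
lemma prod_two_mul_sin {p m : ℕ} (hm : 2 * m + 1 = p) :
    ∏ k ∈ range m, (2 * Real.sin (Real.pi * (k + 1 : ℕ) / p)) = Real.sqrt p := by
  have : NeZero p := ⟨by omega⟩
  have hp : (p : ℝ) ≠ 0 := NeZero.ne _
  have hξ : IsPrimitiveRoot (rootXi p) (m + m + 1) := by
    rw [← two_mul, hm]; exact rootXi_isPrimitiveRoot p
  have h := congrArg norm hξ.prod_one_sub_pow_eq_order
  rw [norm_prod, ← Nat.cast_add_one, Complex.norm_natCast, ← two_mul, hm, two_mul,
    prod_range_add] at h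
  have h1 : ∏ k ∈ range m, ‖1 - rootXi p ^ (k + 1)‖ =
      ∏ k ∈ range m, (2 * Real.sin (Real.pi * (k + 1 : ℕ) / p)) :=
    prod_congr rfl fun k hk =>
      norm_one_sub_rootXi_pow hm (by have := mem_range.1 hk; omega)
  have h2 : ∏ k ∈ range m, ‖1 - rootXi p ^ (m + k + 1)‖ =
      ∏ k ∈ range m, (2 * Real.sin (Real.pi * (k + 1 : ℕ) / p)) := by
    rw [← prod_range_reflect]
    refine prod_congr rfl fun k hk => ?_
    have hk := mem_range.1 hk
    rw [norm_one_sub_rootXi_pow hm (by omega), ← Real.sin_pi_sub]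
    have e : ((m + (m - 1 - k) + 1 : ℕ) : ℝ) = p - (k + 1 : ℕ) := by
      rw [eq_sub_iff_add_eq, ← Nat.cast_add]
      congr 1
      omega
    rw [e]
    congr 2
    field_simp
    ring
  rw [h1, h2, ← pow_two] at h
  refine ((Real.sqrt_eq_iff_eq_sq p.cast_nonneg (prod_nonneg fun k hk => ?_)).2 h.symm).symm
  have hk := mem_range.1 hk
  exact mul_nonneg zero_le_two (sin_pi_mul_div_nonneg (by omega))

lemma prod_neg_one_pow_mul_I (t : ℕ) :
    ∏ k ∈ range (2 * t), ((-1) ^ (k + 1) * Complex.I) = 1 := by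
  induction t with
  | zero => simp
  | succ t ih =>
    rw [mul_add_one, prod_range_succ, prod_range_succ, ih]
    have h : ((-1 : ℂ) ^ t) ^ 2 = 1 := by rw [← pow_mul, mul_comm, pow_mul]; simp
    linear_combination (-((-1 : ℂ) ^ t) ^ 4) * Complex.I_sq + (((-1 : ℂ) ^ t) ^ 2 + 1) * h

lemma aeval_sineProdPoly {p m : ℕ} [Fact p.Prime] (hm : 2 * m + 1 = p) :
    aeval (rootXi p) (sineProdPoly m) = (-1) ^ m * sqrtPStar p := by
  simp only [sineProdPoly, map_prod, map_mul, map_sub, map_pow, aeval_X, map_one,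
    rootXi_pow_mul_sub_one hm]
  rw [prod_mul_distrib, ← Complex.ofReal_prod, prod_two_mul_sin hm, sqrtPStar]
  obtain ⟨t, rfl | rfl⟩ := Nat.even_or_odd' m
  · rw [prod_neg_one_pow_mul_I, if_pos (by omega)]
    simp
  · rw [prod_range_succ, prod_neg_one_pow_mul_I, if_neg (by omega)]
    simp [pow_succ, pow_mul]

lemma aeval_gaussPoly (p : ℕ) [Fact p.Prime] :
    aeval (rootXi p) (gaussPoly p) = ∑ j, ((quadraticChar (ZMod p) j : ℤ) : ℂ) * ep p j := by
  simp [gaussPoly, ep_eq_pow]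

/-- **Gauss's theorem on the sign of the quadratic Gauss sum.** -/
theorem sum_quadraticChar_mul_ep (p : ℕ) [hp' : Fact p.Prime] (hp : p ≠ 2) :
    ∑ j, ((quadraticChar (ZMod p) j : ℤ) : ℂ) * ep p j = sqrtPStar p := by
  obtain ⟨m, hm⟩ : ∃ m, 2 * m + 1 = p :=
    ⟨p / 2, Nat.two_mul_div_two_add_one_of_odd (hp'.out.odd_of_ne_two hp)⟩
  have h2 := hp'.out.two_le
  rcases sq_eq_sq_iff_eq_or_eq_neg.1
    ((sum_quadraticChar_mul_ep_sq p hp).trans (sqrtPStar_sq p hp).symm) with h | h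
  · exact h
  have hone : ((-1 : ℂ) ^ m) * (-1) ^ m = 1 := by rw [← mul_pow]; simp
  have hzero : aeval (rootXi p) (gaussPoly p + C ((-1) ^ m) * sineProdPoly m) = 0 := by
    rw [map_add, map_mul, aeval_gaussPoly, aeval_sineProdPoly hm, h, aeval_C]
    simp only [eq_intCast, Int.cast_pow, Int.cast_neg, Int.cast_one]
    linear_combination sqrtPStar p * hone
  have hc := coeff_comp_eq_zero_of_aeval_eq_zero p _ hzero (m := m) (by omega)
  rw [Polynomial.map_add, Polynomial.map_mul, map_C, add_comp, mul_comp, C_comp, coeff_add,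
    coeff_C_mul, coeff_sineProdPoly_comp] at hc
  have hg := factorial_mul_coeff_gaussPoly_comp p hm
  have hf := factorial_sq_zmod p hm
  have hone' : ((-1 : ZMod p) ^ m) * (-1) ^ m = 1 := by rw [← mul_pow]; simp
  have : (2 : ZMod p) = 0 := by
    simp only [eq_intCast, Int.cast_pow, Int.cast_neg, Int.cast_one] at hc
    linear_combination -(m.factorial : ZMod p) * hc + hg + (-1) ^ m * hf - hone'
  rw [← Nat.cast_two, ZMod.natCast_eq_zero_iff] at this
  exact absurd (Nat.le_of_dvd two_pos this) (by omega)

/-- The additive character `x ↦ ξ_p^{Tr x}` of `F`. -/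
def traceChar (p : ℕ) [Fact p.Prime] (F : Type*) [Field F] [Algebra (ZMod p) F] : AddChar F ℂ :=
  (ZMod.stdAddChar (N := p)).compAddMonoidHom (Algebra.trace (ZMod p) F).toAddMonoidHom

lemma traceChar_apply {p : ℕ} [Fact p.Prime] {F : Type*} [Field F] [Algebra (ZMod p) F] (x : F) :
    traceChar p F x = ep p (Algebra.trace (ZMod p) F x) := by
  rw [ep_eq_stdAddChar]
  rfl

section Plateaued

variable {p n s : ℕ} [Fact p.Prime] {F : Type*} [Field F] [Fintype F] [Algebra (ZMod p) F]

lemma traceChar_isPrimitive : (traceChar p F).IsPrimitive := by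
  refine AddChar.IsPrimitive.of_ne_one (AddChar.ne_one_iff.2 ?_)
  obtain ⟨x, hx⟩ := DFunLike.ne_iff.1 (Algebra.trace_ne_zero (ZMod p) F)
  refine ⟨x, fun h => hx ?_⟩
  rw [traceChar_apply, ep_eq_stdAddChar, ← AddChar.map_zero_eq_one (ZMod.stdAddChar (N := p))] at h
  exact ZMod.injective_stdAddChar h

lemma sum_traceChar_mul (y : F) :
    ∑ β : F, traceChar p F (β * y) = if y = 0 then (Fintype.card F : ℂ) else 0 := by
  rw [AddChar.sum_mulShift y traceChar_isPrimitive]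
  split_ifs <;> simp

lemma walsh_eq (f : F → ZMod p) (β : F) :
    walsh p f β = ∑ x, ep p (f x) * traceChar p F (-(β * x)) := by
  refine sum_congr rfl fun x _ => ?_
  rw [traceChar_apply, map_neg, sub_eq_add_neg]
  simp only [ep_eq_stdAddChar, AddChar.map_add_eq_mul]

lemma sum_walsh (f : F → ZMod p) : ∑ β, walsh p f β = Fintype.card F * ep p (f 0) := by
  simp only [walsh_eq, ← mul_neg]
  rw [sum_comm]
  simp only [← mul_sum, sum_traceChar_mul, neg_eq_zero]
  simp [mul_comm]

lemma conj_ep (j : ZMod p) : starRingEnd ℂ (ep p j) = ep p (-j) := by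
  simp only [ep_eq_stdAddChar, AddChar.map_neg_eq_conj]

/-- **Parseval's identity** for the Walsh transform. -/
lemma sum_norm_sq_walsh (f : F → ZMod p) :
    ∑ β, ‖walsh p f β‖ ^ 2 = (Fintype.card F : ℝ) ^ 2 := by
  have key (β : F) : ((‖walsh p f β‖ ^ 2 : ℝ) : ℂ) =
      ∑ x, ∑ y, ep p (f x) * ep p (-f y) * traceChar p F (β * (y - x)) := by
    rw [Complex.ofReal_pow, ← Complex.mul_conj', walsh_eq, map_sum, sum_mul_sum]
    refine sum_congr rfl fun x _ => sum_congr rfl fun y _ => ?_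
    rw [map_mul, conj_ep, ← AddChar.map_neg_eq_conj, neg_neg, mul_sub, sub_eq_neg_add,
      AddChar.map_add_eq_mul]
    ring
  rw [← Complex.ofReal_inj, Complex.ofReal_sum]
  simp only [key]
  rw [sum_comm]
  have inner (x : F) : ∑ β, ∑ y, ep p (f x) * ep p (-f y) * traceChar p F (β * (y - x)) =
      Fintype.card F := by
    rw [sum_comm]
    simp only [← mul_sum, sum_traceChar_mul, sub_eq_zero]
    simp [ep_eq_stdAddChar, ← AddChar.map_add_eq_mul]
  simp [inner, pow_two]

lemma norm_sqrtPStar_sq (hp : p ≠ 2) : ‖sqrtPStar p‖ ^ 2 = p := by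
  rw [← norm_pow, sqrtPStar_sq p hp]
  rcases mod_four_eq_one_or_three p hp with h | h
  · simp [eta0_neg_one_of_mod_four_eq_one p h]
  · simp [eta0_neg_one_of_mod_four_eq_three p h]

lemma eta0_neg_one_sq (hp : p ≠ 2) : eta0 p (-1) ^ 2 = 1 := by
  rcases mod_four_eq_one_or_three p hp with h | h
  · simp [eta0_neg_one_of_mod_four_eq_one p h]
  · simp [eta0_neg_one_of_mod_four_eq_three p h]

lemma sqrtPStar_ne_zero (hp : p ≠ 2) : sqrtPStar p ≠ 0 := by
  intro h
  have := norm_sqrtPStar_sq hp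
  rw [h, norm_zero, zero_pow two_ne_zero] at this
  exact NeZero.ne (p : ℝ) this.symm

lemma norm_ep (j : ZMod p) : ‖ep p j‖ = 1 := by
  rw [ep_eq_stdAddChar]
  exact AddChar.norm_apply _ _

variable {f g : F → ZMod p} {ε : ℂ}

/-- The Walsh support of a plateaued function has `p ^ (n - s)` elements. -/
lemma IsWeaklyRegularPlateaued.card_support (hp : p ≠ 2) (hs : s ≤ n)
    (hq : Fintype.card F = p ^ n) (hf : IsWeaklyRegularPlateaued p n s f ε g) :
    #{β : F | walsh p f β ≠ 0} = p ^ (n - s) := by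
  obtain ⟨hε, hw, -⟩ := hf
  have hε1 : ‖ε‖ = 1 := by rcases hε with rfl | rfl <;> simp
  have h := sum_norm_sq_walsh f
  have hβ (β : F) : ‖walsh p f β‖ ^ 2 = if walsh p f β ≠ 0 then (p : ℝ) ^ (n + s) else 0 := by
    split_ifs with h0
    · rw [hw β h0, norm_mul, norm_mul, hε1, norm_ep, norm_pow, one_mul, mul_one, ← pow_mul,
        mul_comm, pow_mul, norm_sqrtPStar_sq hp]
    · simp [not_not.1 h0]
  simp only [hβ] at h
  rw [← sum_filter, sum_const, nsmul_eq_mul, hq] at h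
  have h' : #{β : F | walsh p f β ≠ 0} * p ^ (n + s) = p ^ (n - s) * p ^ (n + s) := by
    rw [← pow_add, show n - s + (n + s) = n * 2 by omega, pow_mul]
    exact_mod_cast h
  exact Nat.eq_of_mul_eq_mul_right (pow_pos (Nat.pos_of_neZero p) _) h'

lemma IsWeaklyRegularPlateaued.sum_ep_dual (hp : p ≠ 2) (hs : s ≤ n)
    (hq : Fintype.card F = p ^ n) (hf : IsWeaklyRegularPlateaued p n s f ε g) (h0 : f 0 = 0) :
    ∑ β : F with walsh p f β ≠ 0, ep p (g β) = ε * eta0 p (-1) ^ n * sqrtPStar p ^ (n - s) := by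
  obtain ⟨hε, hw, -⟩ := hf
  have hε2 : ε * ε = 1 := by rcases hε with rfl | rfl <;> simp
  have hP := sqrtPStar_ne_zero hp
  have hε0 : ε ≠ 0 := left_ne_zero_of_mul_eq_one hε2
  have h := sum_walsh f
  rw [h0, ep_eq_stdAddChar, AddChar.map_zero_eq_one, mul_one, hq, ← sum_filter_ne_zero,
    sum_congr rfl fun β hβ => hw β (mem_filter.1 hβ).2, ← mul_sum] at h
  apply mul_left_cancel₀ (mul_ne_zero hε0 (pow_ne_zero (n + s) hP))
  have hη : (eta0 p (-1) ^ n) * eta0 p (-1) ^ n = 1 := by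
    rw [← mul_pow, ← pow_two, eta0_neg_one_sq hp, one_pow]
  have hPn : sqrtPStar p ^ (n + s) * sqrtPStar p ^ (n - s) = eta0 p (-1) ^ n * (p : ℂ) ^ n := by
    rw [← pow_add, show n + s + (n - s) = 2 * n by omega, pow_mul, sqrtPStar_sq p hp, mul_pow]
  rw [h, Nat.cast_pow]
  linear_combination -(p : ℂ) ^ n * hη - eta0 p (-1) ^ n * hPn -
    (sqrtPStar p ^ (n + s) * eta0 p (-1) ^ n * sqrtPStar p ^ (n - s)) * hε2

/-- An integral expansion of `∑ ξ_p^{g(β)}` in powers of `ξ_p` determines the value distribution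
of the dual `g` on the Walsh support. -/
lemma IsWeaklyRegularPlateaued.card_dual_eq (hp : p ≠ 2) (hs : s ≤ n)
    (hq : Fintype.card F = p ^ n) (hf : IsWeaklyRegularPlateaued p n s f ε g) (h0 : f 0 = 0)
    (b : ZMod p → ℤ)
    (hb : ∑ j, (b j : ℂ) * ep p j = ε * eta0 p (-1) ^ n * sqrtPStar p ^ (n - s)) (j : ZMod p) :
    (#{β : F | walsh p f β ≠ 0 ∧ g β = j} : ℂ) =
      (p : ℂ) ^ (n - s) / p - ((∑ i, b i : ℤ) : ℂ) / p + b j := by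
  have hp0 : (p : ℂ) ≠ 0 := NeZero.ne _
  set N : ZMod p → ℕ := fun j => #{β : F | walsh p f β ≠ 0 ∧ g β = j}
  have hsum : ∑ i, (N i : ℂ) * ep p i = ε * eta0 p (-1) ^ n * sqrtPStar p ^ (n - s) := by
    rw [← hf.sum_ep_dual hp hs hq h0, ← sum_fiberwise _ g]
    refine sum_congr rfl fun i _ => ?_
    rw [sum_congr rfl fun β hβ => by rw [(mem_filter.1 hβ).2], sum_const, nsmul_eq_mul,
      filter_filter]
  have hcard : ∑ i, (N i : ℤ) = (p : ℤ) ^ (n - s) := by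
    have := card_eq_sum_card_fiberwise (f := g) (s := {β : F | walsh p f β ≠ 0}) (t := univ)
      (by simp)
    rw [hf.card_support hp hs hq] at this
    simp only [filter_filter] at this
    exact_mod_cast this.symm
  have hconst := eq_of_sum_ep_eq_zero p (fun i => (N i : ℤ) - b i) (by
    simp only [Int.cast_sub, Int.cast_natCast, sub_mul, sum_sub_distrib, hsum, hb, sub_self])
  have htot : ∑ i, ((N i : ℤ) - b i) = p * ((N j : ℤ) - b j) := by
    rw [sum_congr rfl fun i _ => hconst i j, sum_const, card_univ, ZMod.card, nsmul_eq_mul]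
  rw [sum_sub_distrib, hcard] at htot
  have htot' : (p : ℂ) ^ (n - s) - ((∑ i, b i : ℤ) : ℂ) = p * ((N j : ℂ) - b j) := by
    exact_mod_cast htot
  rw [← sub_div, htot', mul_div_cancel_left₀ _ hp0, sub_add_cancel]

end Plateaued

theorem statement_6 (p n s : ℕ) [Fact p.Prime] (hp : p ≠ 2) (hn : 0 < n) (hs : s ≤ n)
    {F : Type*} [Field F] [Fintype F] [Algebra (ZMod p) F]
    (hq : Fintype.card F = p ^ n)
    (f g : F → ZMod p) (ε : ℂ)
    (hf : IsWRP p n s f ε g) :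
    (Even (n - s) →
      ((Finset.univ.filter fun β : F => walsh p f β ≠ 0 ∧ g β = 0).card : ℂ)
          = (p : ℂ) ^ ((n : ℤ) - s - 1)
            + ε * (eta0 p (-1)) ^ (n + 1) * ((p : ℂ) - 1)
              * sqrtPStar p ^ ((n : ℤ) - s - 2) ∧
      ∀ j : ZMod p, j ≠ 0 →
        ((Finset.univ.filter fun β : F => walsh p f β ≠ 0 ∧ g β = j).card : ℂ)
          = (p : ℂ) ^ ((n : ℤ) - s - 1)
            - ε * (eta0 p (-1)) ^ (n + 1) * sqrtPStar p ^ ((n : ℤ) - s - 2)) ∧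
    (Odd (n - s) →
      ((Finset.univ.filter fun β : F => walsh p f β ≠ 0 ∧ g β = 0).card : ℂ)
          = (p : ℂ) ^ ((n : ℤ) - s - 1) ∧
      (∀ j : ZMod p, j ≠ 0 → IsSquare j →
        ((Finset.univ.filter fun β : F => walsh p f β ≠ 0 ∧ g β = j).card : ℂ)
          = (p : ℂ) ^ ((n : ℤ) - s - 1)
            + ε * (eta0 p (-1)) ^ n * sqrtPStar p ^ ((n : ℤ) - s - 1)) ∧
      (∀ j : ZMod p, j ≠ 0 → ¬ IsSquare j →
        ((Finset.univ.filter fun β : F => walsh p f β ≠ 0 ∧ g β = j).card : ℂ)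
          = (p : ℂ) ^ ((n : ℤ) - s - 1)
            - ε * (eta0 p (-1)) ^ n * sqrtPStar p ^ ((n : ℤ) - s - 1))) := by
  obtain ⟨hw, -, h0, -⟩ := hf
  have hp0 : (p : ℂ) ≠ 0 := NeZero.ne _
  have hP := sqrtPStar_ne_zero hp
  have hP2 := sqrtPStar_sq p hp
  have hη := eta0_neg_one_sq hp
  have hη0 : eta0 p (-1) ≠ 0 := fun h => by simp [h] at hη
  have hpz : (p : ℂ) ^ ((n : ℤ) - s - 1) = (p : ℂ) ^ (n - s) / p := by
    rw [zpow_sub_one₀ hp0, ← Nat.cast_sub hs, zpow_natCast, div_eq_mul_inv]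
  have hint (e : ℕ) : ∃ c : ℤ, (c : ℂ) = ε * eta0 p (-1) ^ n * sqrtPStar p ^ (2 * e) := by
    obtain ⟨ε', rfl⟩ : ∃ ε' : ℤ, (ε' : ℂ) = ε := by
      rcases hw.1 with rfl | rfl
      · exact ⟨1, Int.cast_one⟩
      · exact ⟨-1, by simp⟩
    refine ⟨ε' * quadraticChar (ZMod p) (-1) ^ n * (quadraticChar (ZMod p) (-1) * p) ^ e, ?_⟩
    rw [pow_mul, hP2, eta0]
    push_cast
    ring
  rw [hpz]
  constructor
  · intro heven
    obtain ⟨e, he⟩ := heven.two_dvd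
    obtain ⟨c, hc⟩ := hint e
    rw [← he] at hc
    have hcount := hw.card_dual_eq hp hs hq h0 (fun i => if i = 0 then c else 0) (by
      simp [hc, ep_eq_stdAddChar])
    have hcp : ε * eta0 p (-1) ^ (n + 1) * sqrtPStar p ^ ((n : ℤ) - s - 2) = c / p := by
      rw [zpow_sub₀ hP, ← Nat.cast_sub hs, zpow_natCast, hc, zpow_ofNat, hP2]
      field_simp
      ring
    simp only [sum_ite_eq', mem_univ, if_true] at hcount
    refine ⟨?_, fun j hj => ?_⟩
    · rw [hcount 0, if_pos rfl, mul_right_comm, hcp]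
      field_simp
      ring
    · rw [hcount j, if_neg hj, hcp, Int.cast_zero, add_zero]
  · intro hodd
    obtain ⟨e, he⟩ := hodd
    obtain ⟨c, hc⟩ := hint e
    have hc2 : ringChar (ZMod p) ≠ 2 := by rwa [ZMod.ringChar_zmod_n]
    have hcount := hw.card_dual_eq hp hs hq h0 (fun i => c * quadraticChar (ZMod p) i) (by
      simp only [Int.cast_mul, mul_assoc, ← mul_sum]
      rw [sum_quadraticChar_mul_ep p hp, hc, he, pow_succ]
      ring)
    have hcz : ε * eta0 p (-1) ^ n * sqrtPStar p ^ ((n : ℤ) - s - 1) = c := by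
      rw [zpow_sub_one₀ hP, ← Nat.cast_sub hs, zpow_natCast, hc, he, pow_succ,
        mul_inv_cancel_right₀ hP]
    simp only [← mul_sum, quadraticChar_sum_zero hc2, mul_zero, Int.cast_zero, zero_div,
      sub_zero] at hcount
    refine ⟨?_, fun j hj hsq => ?_, fun j hj hsq => ?_⟩
    · simp [hcount 0]
    · rw [hcount j, hcz, (quadraticChar_one_iff_isSquare hj).2 hsq, mul_one]
    · rw [hcount j, hcz, quadraticChar_neg_one_iff_not_isSquare.2 hsq, mul_neg_one, Int.cast_neg,
        sub_eq_add_neg]
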